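/- Let W be a standard Brownian motion and let D_k be the event {|W(2^{k-1}) - (W(2^k) - W(2^{k-1}))| ≥ M 2^{k/2+1}} for k ≥ 1, where M > 0 is fixed. Then for every k ≥ 2, P(D_k | ∩_{j=1}^{k-1} D_j^c) ≥ (1/2) P(|Z| ≥ 2^{3/2} M), where Z is a standard normal random variable. -/

import Mathlib

open MeasureTheory ProbabilityTheory Filter
open scoped ENNReal NNReal

noncomputable section

/-- A standard Brownian motion: a centered Gaussian process indexed by nonnegative
times with covariance `min s t` and almost surely continuous sample paths on `[0,∞)`. -/
def IsStdBM {Ω : Type*} [MeasureSpace Ω] (W : ℝ → Ω → ℝ) : Prop :=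
  (∀ t : ℝ, Measurable (W t)) ∧
  (∀ᵐ ω ∂(volume : Measure Ω), ContinuousOn (fun t => W t ω) (Set.Ici 0)) ∧
  ∀ (n : ℕ) (c t : Fin n → ℝ), (∀ i, 0 ≤ t i) →
    Measure.map (fun ω => ∑ i, c i * W (t i) ω) volume =
      gaussianReal 0 (Real.toNNReal (∑ i, ∑ j, c i * c j * min (t i) (t j)))

theorem measure_preimage_inter_eq_setLIntegral_of_indepFun {Ω E F : Type*}
    [MeasurableSpace Ω] [MeasurableSpace E] [MeasurableSpace F] {P : Measure Ω}
    [IsProbabilityMeasure P] {X : Ω → E} {Y : Ω → F} (hX : Measurable X) (hY : Measurable Y)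
    (h : IndepFun X Y P) {S : Set E} (hS : MeasurableSet S) {T : Set (E × F)}
    (hT : MeasurableSet T) :
    P (X ⁻¹' S ∩ (fun ω => (X ω, Y ω)) ⁻¹' T) =
      ∫⁻ x in S, P.map Y (Prod.mk x ⁻¹' T) ∂(P.map X) := by
  have hXY : Measurable fun ω => (X ω, Y ω) := hX.prodMk hY
  have h1 : X ⁻¹' S ∩ (fun ω => (X ω, Y ω)) ⁻¹' T =
      (fun ω => (X ω, Y ω)) ⁻¹' (Prod.fst ⁻¹' S ∩ T) := rfl
  have := Measure.isProbabilityMeasure_map (μ := P) hY.aemeasurable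
  rw [h1, ← Measure.map_apply hXY ((measurable_fst hS).inter hT),
    (indepFun_iff_map_prod_eq_prod_map_map hX.aemeasurable hY.aemeasurable).1 h,
    Measure.prod_apply ((measurable_fst hS).inter hT), ← lintegral_indicator hS]
  congr with x
  by_cases hx : x ∈ S <;> simp [hx, Set.preimage]

theorem gaussianReal_le_neg (v : ℝ≥0) (c : ℝ) :
    gaussianReal 0 v {y | y ≤ -c} = gaussianReal 0 v {y | c ≤ y} := by
  have h := gaussianReal_map_neg (μ := 0) (v := v)
  rw [neg_zero] at h
  conv_rhs =>
    rw [← h, Measure.map_apply (by fun_prop) (measurableSet_le (by fun_prop) (by fun_prop))]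
  congr 1
  ext y
  simp [le_neg]

theorem gaussianReal_le_abs (v : ℝ≥0) (c : ℝ) :
    gaussianReal 0 v {y | c ≤ |y|} ≤ 2 * gaussianReal 0 v {y | c ≤ y} := by
  have hsub : {y : ℝ | c ≤ |y|} ⊆ {y | c ≤ y} ∪ {y | y ≤ -c} := by
    intro y hy
    rcases le_abs.1 (show c ≤ |y| from hy) with h | h
    · exact Or.inl h
    · exact Or.inr (show y ≤ -c by linarith)
  refine (measure_mono hsub).trans ((measure_union_le _ _).trans ?_)
  rw [gaussianReal_le_neg, two_mul]

theorem half_gaussianReal_abs_ge_le (v : ℝ≥0) (c x : ℝ) :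
    1 / 2 * gaussianReal 0 v {y | c ≤ |y|} ≤ gaussianReal 0 v {y | c ≤ |x - y|} := by
  have hhalf : 1 / 2 * gaussianReal 0 v {y | c ≤ |y|} ≤ gaussianReal 0 v {y | c ≤ y} := by
    rw [one_div, ENNReal.inv_mul_le_iff (by simp) (by simp)]
    exact gaussianReal_le_abs v c
  rcases le_total x 0 with hx | hx
  · refine hhalf.trans (measure_mono fun y (hy : c ≤ y) => ?_)
    change c ≤ |x - y|
    exact le_abs.2 (Or.inr (by linarith))
  · refine (hhalf.trans (gaussianReal_le_neg v c).ge).trans (measure_mono fun y (hy : y ≤ -c) => ?_)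
    change c ≤ |x - y|
    exact le_abs.2 (Or.inl (by linarith))

theorem gaussianReal_abs_sub_lt_pos {v : ℝ≥0} (hv : v ≠ 0) {c : ℝ} (hc : 0 < c) (x : ℝ) :
    0 < gaussianReal 0 v {y | |x - y| < c} := by
  refine pos_iff_ne_zero.2 fun h => ?_
  have h1 := gaussianReal_absolutelyContinuous' 0 hv h
  refine (IsOpen.measure_pos volume (isOpen_lt (by fun_prop) continuous_const) ⟨x, ?_⟩).ne' h1
  simpa using hc

theorem gaussianReal_sq_mul_abs_ge {s : ℝ≥0} (hs : 0 < s) (a : ℝ) :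
    gaussianReal 0 (s ^ 2) {y | s * a ≤ |y|} = gaussianReal 0 1 {y | a ≤ |y|} := by
  have h := gaussianReal_map_const_mul (μ := 0) (v := 1) (s : ℝ)
  have h1 : gaussianReal 0 (s ^ 2) = (gaussianReal 0 1).map ((s : ℝ) * ·) := by
    rw [h]
    congr 1
    · simp
    · ext; simp
  rw [h1, Measure.map_apply (by fun_prop) (measurableSet_le (by fun_prop) (by fun_prop))]
  congr 1
  ext y
  simp [abs_mul, hs]

theorem IsStdBM.isPreBrownianReal {Ω : Type*} [MeasureSpace Ω]
    [IsProbabilityMeasure (volume : Measure Ω)] {W : ℝ → Ω → ℝ} (hW : IsStdBM W) :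
    IsPreBrownianReal (fun t : ℝ≥0 => W t) volume := by
  obtain ⟨hm, -, hlaw⟩ := hW
  have hG : IsGaussianProcess (fun t : ℝ≥0 => W t) (volume : Measure Ω) := by
    refine ⟨fun I => ⟨isGaussian_of_map_eq_gaussianReal fun L => ?_⟩⟩
    have hmI : Measurable fun ω => I.restrict fun t : ℝ≥0 => W t ω :=
      measurable_pi_lambda _ fun i => hm _
    let e := I.equivFin.symm
    have h := hlaw I.card (fun i => L (Pi.single (e i) 1)) (fun i => ((e i : ℝ≥0) : ℝ))
      fun i => NNReal.coe_nonneg _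
    refine ⟨0, _, Eq.trans ?_ h⟩
    rw [Measure.map_map (by fun_prop) hmI]
    congr 1
    ext ω
    rw [Function.comp_apply, ← ContinuousLinearMap.coe_coe, LinearMap.pi_apply_eq_sum_univ,
      ← e.sum_comp]
    refine Finset.sum_congr rfl fun i _ => ?_
    rw [smul_eq_mul, mul_comm, Finset.restrict]
    congr 3
    ext j
    simp [Pi.single_apply, eq_comm]
  have hlaw1 (t : ℝ≥0) : HasLaw (W t) (gaussianReal 0 t) (volume : Measure Ω) :=
    ⟨(hm t).aemeasurable, by simpa using hlaw 1 (fun _ => 1) (fun _ => t) (by simp)⟩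
  have hmean (t : ℝ≥0) : ∫ ω, W t ω = 0 := by
    rw [(hlaw1 t).integral_eq, integral_id_gaussianReal]
  refine hG.isPreBrownianReal_of_covariance hmean fun s t hst => ?_
  have hsub : HasLaw (W s - W t) (gaussianReal 0 (t - s)) (volume : Measure Ω) := by
    refine ⟨((hm s).sub (hm t)).aemeasurable, ?_⟩
    have hst' : (s : ℝ) ≤ t := hst
    have h := hlaw 2 ![1, -1] ![s, t] (by simp [Fin.forall_fin_two])
    simp [Fin.sum_univ_two, min_eq_left hst', min_eq_right hst'] at h
    convert h using 2
    · ext ω; simp [sub_eq_add_neg]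
    · ext
      rw [NNReal.coe_sub hst, Real.coe_toNNReal _ (by linarith)]
      ring
  have hv := variance_sub (hG.hasGaussianLaw_eval s).memLp_two (hG.hasGaussianLaw_eval t).memLp_two
  rw [hsub.variance_eq, (hlaw1 s).variance_eq, (hlaw1 t).variance_eq] at hv
  simp only [variance_id_gaussianReal, NNReal.coe_sub hst] at hv
  linarith

theorem ProbabilityTheory.IsPreBrownianReal.indepFun_two_pow {Ω : Type*} [MeasurableSpace Ω] {P : Measure Ω}
    {B : ℝ≥0 → Ω → ℝ} (hB : IsPreBrownianReal B P) (n : ℕ) :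
    IndepFun (fun ω (j : ℕ) => B (2 ^ min j n) ω) (B (2 ^ (n + 1)) - B (2 ^ n)) P := by
  have h := hB.indepFun_shift (2 ^ n)
  have hle (j : ℕ) : (2 : ℝ≥0) ^ min j n ∈ Set.Iic ((2 : ℝ≥0) ^ n) :=
    Set.mem_Iic.2 (pow_le_pow_right₀ one_le_two (min_le_right j n))
  have hφ : Measurable fun (x : Set.Iic ((2 : ℝ≥0) ^ n) → ℝ) (j : ℕ) => x ⟨2 ^ min j n, hle j⟩ :=
    measurable_pi_lambda _ fun j => measurable_pi_apply _
  have h' := h.symm.comp hφ (measurable_pi_apply ((2 : ℝ≥0) ^ n))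
  rwa [show B (2 ^ (n + 1)) - B (2 ^ n) = (fun ω => B (2 ^ n + 2 ^ n) ω - B (2 ^ n) ω) by
    rw [pow_succ, mul_two]; rfl]

theorem ProbabilityTheory.IsPreBrownianReal.hasLaw_two_pow_sub {Ω : Type*} [MeasurableSpace Ω] {P : Measure Ω}
    {B : ℝ≥0 → Ω → ℝ} (hB : IsPreBrownianReal B P) (n : ℕ) :
    HasLaw (B (2 ^ (n + 1)) - B (2 ^ n)) (gaussianReal 0 (2 ^ n)) P := by
  rw [pow_succ, mul_two]
  exact (hB.shift (2 ^ n)).hasLaw_eval (2 ^ n)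

/-- The probability that the differences of `Z (j - 1)` and the `j`-th increment stay small up to
time `n` and that `(Z n, Z (n + 1) - Z n) ∈ T`, computed by integrating out the last increment when
it is independent of the past. -/
theorem measure_small_differences_inter {Ω : Type*} [MeasurableSpace Ω] {P : Measure Ω}
    [IsProbabilityMeasure P] {Z : ℕ → Ω → ℝ} (hZ : ∀ n, Measurable (Z n)) (c : ℕ → ℝ) (n : ℕ)
    (hind : IndepFun (fun ω j => Z (min j n) ω) (Z (n + 1) - Z n) P)
    {T : Set (ℝ × ℝ)} (hT : MeasurableSet T) :
    P ((⋂ j ∈ Finset.Icc 1 n, {ω | c j ≤ |Z (j - 1) ω - (Z j ω - Z (j - 1) ω)|}ᶜ) ∩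
        {ω | (Z n ω, Z (n + 1) ω - Z n ω) ∈ T}) =
      ∫⁻ ω in ⋂ j ∈ Finset.Icc 1 n, {ω | c j ≤ |Z (j - 1) ω - (Z j ω - Z (j - 1) ω)|}ᶜ,
        P.map (Z (n + 1) - Z n) (Prod.mk (Z n ω) ⁻¹' T) ∂P := by
  have hX : Measurable fun ω j => Z (min j n) ω := by fun_prop
  have hY : Measurable (Z (n + 1) - Z n) := by fun_prop
  let S : Set (ℕ → ℝ) := ⋂ j ∈ Finset.Icc 1 n, {x | c j ≤ |x (j - 1) - (x j - x (j - 1))|}ᶜ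
  have hS : MeasurableSet S := Finset.measurableSet_biInter _ fun j _ =>
    (measurableSet_le (by fun_prop) (by fun_prop)).compl
  have hA : (⋂ j ∈ Finset.Icc 1 n, {ω | c j ≤ |Z (j - 1) ω - (Z j ω - Z (j - 1) ω)|}ᶜ) =
      (fun ω j => Z (min j n) ω) ⁻¹' S := by
    simp only [S, Set.preimage_iInter]
    refine Set.iInter₂_congr fun j hj => ?_
    have hj := (Finset.mem_Icc.1 hj).2
    ext ω
    simp [min_eq_left hj, min_eq_left ((Nat.sub_le j 1).trans hj)]
  have hT' : MeasurableSet ((fun p : (ℕ → ℝ) × ℝ => (p.1 n, p.2)) ⁻¹' T) :=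
    hT.preimage (by fun_prop)
  have hYP := Measure.isProbabilityMeasure_map (μ := P) hY.aemeasurable
  have h := measure_preimage_inter_eq_setLIntegral_of_indepFun hX hY hind hS hT'
  rw [hA]
  have hf : Measurable fun x : ℕ → ℝ =>
      P.map (Z (n + 1) - Z n) (Prod.mk x ⁻¹' ((fun p : (ℕ → ℝ) × ℝ => (p.1 n, p.2)) ⁻¹' T)) :=
    measurable_measure_prodMk_left hT'
  rw [setLIntegral_map hS hf hX] at h
  simpa [Set.preimage] using h

theorem measure_small_differences_pos {Ω : Type*} [MeasurableSpace Ω] {P : Measure Ω}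
    [IsProbabilityMeasure P] {Z : ℕ → Ω → ℝ} (hZ : ∀ n, Measurable (Z n)) {v : ℕ → ℝ≥0}
    (hv : ∀ n, v n ≠ 0) {c : ℕ → ℝ} (hc : ∀ n, 0 < c n)
    (hind : ∀ n, IndepFun (fun ω j => Z (min j n) ω) (Z (n + 1) - Z n) P)
    (hlaw : ∀ n, HasLaw (Z (n + 1) - Z n) (gaussianReal 0 (v n)) P) (n : ℕ) :
    0 < P (⋂ j ∈ Finset.Icc 1 n, {ω | c j ≤ |Z (j - 1) ω - (Z j ω - Z (j - 1) ω)|}ᶜ) := by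
  induction n with
  | zero => simp
  | succ n ih =>
    have hT : MeasurableSet {p : ℝ × ℝ | |p.1 - p.2| < c (n + 1)} :=
      measurableSet_lt (by fun_prop) (by fun_prop)
    have h := measure_small_differences_inter hZ c n (hind n) hT
    have hsplit : (⋂ j ∈ Finset.Icc 1 (n + 1),
        {ω | c j ≤ |Z (j - 1) ω - (Z j ω - Z (j - 1) ω)|}ᶜ) =
        (⋂ j ∈ Finset.Icc 1 n, {ω | c j ≤ |Z (j - 1) ω - (Z j ω - Z (j - 1) ω)|}ᶜ) ∩
        {ω | (Z n ω, Z (n + 1) ω - Z n ω) ∈ {p : ℝ × ℝ | |p.1 - p.2| < c (n + 1)}} := by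
      rw [← Finset.insert_Icc_right_eq_Icc_add_one (by omega), Finset.set_biInter_insert,
        Set.inter_comm]
      congr 1
      ext ω
      simp
    have hf : Measurable fun ω => P.map (Z (n + 1) - Z n)
        (Prod.mk (Z n ω) ⁻¹' {p : ℝ × ℝ | |p.1 - p.2| < c (n + 1)}) := by
      rw [(hlaw n).map_eq]
      exact (measurable_measure_prodMk_left hT).comp (hZ n)
    rw [hsplit, h, setLIntegral_pos_iff hf]
    convert ih using 2
    refine Set.inter_eq_right.2 fun ω _ => Function.mem_support.2 ?_
    rw [(hlaw n).map_eq]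
    exact (gaussianReal_abs_sub_lt_pos (hv n) (hc (n + 1)) (Z n ω)).ne'

theorem stmt6 {Ω : Type*} [MeasureSpace Ω] [IsProbabilityMeasure (volume : Measure Ω)]
    (W : ℝ → Ω → ℝ) (hW : IsStdBM W) (M : ℝ) (hM : 0 < M) (k : ℕ) (hk : 2 ≤ k) :
    (1 / 2 : ℝ≥0∞) * gaussianReal 0 1 {x : ℝ | 2 ^ (3 / 2 : ℝ) * M ≤ |x|} ≤
      (ProbabilityTheory.cond volume
          (⋂ j ∈ Finset.Icc 1 (k - 1),
            ({ω | M * 2 ^ ((j : ℝ) / 2 + 1) ≤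
                |W (2 ^ (j - 1)) ω - (W (2 ^ j) ω - W (2 ^ (j - 1)) ω)|}ᶜ)))
        {ω | M * 2 ^ ((k : ℝ) / 2 + 1) ≤
          |W (2 ^ (k - 1)) ω - (W (2 ^ k) ω - W (2 ^ (k - 1)) ω)|} := by
  have hB := hW.isPreBrownianReal
  let Z : ℕ → Ω → ℝ := fun n => W (2 ^ n)
  let c : ℕ → ℝ := fun n => M * 2 ^ ((n : ℝ) / 2 + 1)
  have hZ (n : ℕ) : Measurable (Z n) := hW.1 _
  have hc (n : ℕ) : 0 < c n := by positivity
  have hind (n : ℕ) : IndepFun (fun ω j => Z (min j n) ω) (Z (n + 1) - Z n) volume := by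
    simpa [Z] using hB.indepFun_two_pow n
  have hlaw (n : ℕ) : HasLaw (Z (n + 1) - Z n) (gaussianReal 0 (2 ^ n)) volume := by
    simpa [Z] using hB.hasLaw_two_pow_sub n
  obtain ⟨n, rfl⟩ : ∃ n, k = n + 1 := ⟨k - 1, by omega⟩
  have hpos := measure_small_differences_pos hZ (fun n => by positivity) hc hind hlaw n
  have hT : MeasurableSet {p : ℝ × ℝ | c (n + 1) ≤ |p.1 - p.2|} :=
    measurableSet_le (by fun_prop) (by fun_prop)
  have h := measure_small_differences_inter hZ c n (hind n) hT
  have hscale : gaussianReal 0 1 {x : ℝ | 2 ^ (3 / 2 : ℝ) * M ≤ |x|} =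
      gaussianReal 0 (2 ^ n) {y | c (n + 1) ≤ |y|} := by
    have hs : (0 : ℝ≥0) < 2 ^ ((n : ℝ) / 2) := NNReal.rpow_pos two_pos
    rw [← gaussianReal_sq_mul_abs_ge hs]
    have h1 : ((2 : ℝ≥0) ^ ((n : ℝ) / 2)) ^ 2 = 2 ^ n := by
      rw [← NNReal.rpow_natCast, ← NNReal.rpow_mul, ← NNReal.rpow_natCast]
      congr 1
      push_cast
      ring
    have h2 : (((2 : ℝ≥0) ^ ((n : ℝ) / 2) : ℝ≥0) : ℝ) * (2 ^ (3 / 2 : ℝ) * M) = c (n + 1) := by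
      rw [NNReal.coe_rpow, ← mul_assoc, NNReal.coe_ofNat, ← Real.rpow_add two_pos, mul_comm]
      simp only [c]
      congr 2
      push_cast
      ring
    rw [h1, h2]
  have hA : MeasurableSet
      (⋂ j ∈ Finset.Icc 1 n, {ω | c j ≤ |Z (j - 1) ω - (Z j ω - Z (j - 1) ω)|}ᶜ) :=
    Finset.measurableSet_biInter _ fun j _ => (measurableSet_le (by fun_prop) (by fun_prop)).compl
  rw [Nat.add_sub_cancel, hscale]
  change _ ≤ cond volume
    (⋂ j ∈ Finset.Icc 1 n, {ω | c j ≤ |Z (j - 1) ω - (Z j ω - Z (j - 1) ω)|}ᶜ)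
    {ω | (Z n ω, Z (n + 1) ω - Z n ω) ∈ {p : ℝ × ℝ | c (n + 1) ≤ |p.1 - p.2|}}
  rw [cond_apply hA, h, mul_comm _ (lintegral _ _), ← div_eq_mul_inv,
    ENNReal.le_div_iff_mul_le (Or.inl hpos.ne') (Or.inl (measure_ne_top _ _)),
    ← setLIntegral_const, (hlaw n).map_eq]
  exact setLIntegral_mono' hA fun ω _ => half_gaussianReal_abs_ge_le _ (c (n + 1)) (Z n ω)
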